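/- The set of transpositions in the symmetric group S₅, equipped with the conjugation operation a ◃ b = b⁻¹ab, is a simple quandle with exactly 10 elements; in particular it is a connected quandle of order 10. -/

import Mathlib

universe u v

/-- A quandle: a set with a binary operation `◃` such that every right
translation `x ↦ x ◃ a` is bijective, the operation is right self-distributive,
and every element is idempotent. -/
class Quandle' (Q : Type u) where
  act : Q → Q → Q
  act_bijective : ∀ a : Q, Function.Bijective fun x => act x a
  act_distrib : ∀ a b c : Q, act (act a b) c = act (act a c) (act b c)
  act_self : ∀ a : Q, act a a = a

infixl:65 " ◃ " => Quandle'.act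

namespace Quandle'

/-- The right translation by `a`, as a permutation of the quandle. -/
noncomputable def rho {Q : Type u} [Quandle' Q] (a : Q) : Equiv.Perm Q :=
  Equiv.ofBijective _ (act_bijective a)

/-- The inner automorphism group of a quandle: the subgroup of the symmetric
group generated by the right translations. -/
noncomputable def Inn (Q : Type u) [Quandle' Q] : Subgroup (Equiv.Perm Q) :=
  Subgroup.closure (Set.range (rho : Q → Equiv.Perm Q))

/-- A quandle is connected if its inner automorphism group acts transitively. -/
def IsConnected (Q : Type u) [Quandle' Q] : Prop :=
  ∀ x y : Q, ∃ g ∈ Inn Q, g x = y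

/-- Quandle homomorphisms. -/
def IsHom {Q : Type u} {R : Type v} [Quandle' Q] [Quandle' R] (f : Q → R) : Prop :=
  ∀ a b : Q, f (a ◃ b) = f a ◃ f b

/-- A quandle is simple if it has more than one element and every quandle
homomorphism out of it is either injective or constant. -/
def IsSimple (Q : Type u) [Quandle' Q] : Prop :=
  Nontrivial Q ∧ ∀ (R : Type u) [Quandle' R] (f : Q → R), IsHom f →
    Function.Injective f ∨ ∀ a b : Q, f a = f b

/-- A block for the action of the inner automorphism group. -/
noncomputable def IsBlock (Q : Type u) [Quandle' Q] (B : Set Q) : Prop :=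
  ∀ g ∈ Inn Q, ⇑g '' B = B ∨ Disjoint (⇑g '' B) B

/-- A connected quandle is primitive if the action of its inner automorphism
group preserves no nontrivial partition into blocks. -/
noncomputable def IsPrimitive (Q : Type u) [Quandle' Q] : Prop :=
  IsConnected Q ∧ ∀ B : Set Q, IsBlock Q B → B.Subsingleton ∨ B = Set.univ

end Quandle'

open Quandle'

/-- The conjugacy class of transpositions in the symmetric group `S₅`. -/
abbrev Transposition5 : Type := {σ : Equiv.Perm (Fin 5) // σ.IsSwap}

/-- The conjugation quandle structure `a ◃ b = b⁻¹ * a * b` on the class of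
transpositions of `S₅`. -/
instance : Quandle' Transposition5 where
  act a b := ⟨b.1⁻¹ * a.1 * b.1, by
    obtain ⟨x, y, hxy, ha⟩ := a.2
    refine ⟨b.1⁻¹ x, b.1⁻¹ y, fun h => hxy (b.1⁻¹.injective h), ?_⟩
    rw [ha, Equiv.swap_apply_apply]
    group⟩
  act_bijective a := by
    constructor
    · intro x y h
      have := Subtype.ext_iff.mp h
      simp only [mul_left_cancel_iff, mul_right_cancel_iff] at this
      exact Subtype.ext this
    · intro y
      refine ⟨⟨a.1 * y.1 * a.1⁻¹, ?_⟩, Subtype.ext (by group)⟩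
      obtain ⟨x, z, hxz, hy⟩ := y.2
      refine ⟨a.1 x, a.1 z, fun h => hxz (a.1.injective h), ?_⟩
      rw [hy, Equiv.swap_apply_apply]
  act_distrib a b c := Subtype.ext (by simp only []; group)
  act_self a := Subtype.ext (by simp only []; group)

namespace Transposition5

/-- The transposition `(i j)` as an element of the quandle. -/
def mk (i j : Fin 5) (h : i ≠ j) : Transposition5 := ⟨Equiv.swap i j, i, j, h, rfl⟩

theorem mk_comm (i j : Fin 5) (h : i ≠ j) : mk i j h = mk j i h.symm :=
  Subtype.ext (Equiv.swap_comm i j)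

theorem exists_eq_mk (a : Transposition5) : ∃ i j h, a = mk i j h := by
  obtain ⟨i, j, h, ha⟩ := a.2
  exact ⟨i, j, h, Subtype.ext ha⟩

theorem mk_act (i j : Fin 5) (h : i ≠ j) (b : Transposition5) :
    mk i j h ◃ b = mk (b.1⁻¹ i) (b.1⁻¹ j) (b.1⁻¹.injective.ne h) := by
  apply Subtype.ext
  change b.1⁻¹ * Equiv.swap i j * b.1 = Equiv.swap (b.1⁻¹ i) (b.1⁻¹ j)
  rw [Equiv.swap_apply_apply, inv_inv]

theorem mk_act_of_adjacent {i j k : Fin 5} (hij : i ≠ j) (hjk : j ≠ k) (hik : i ≠ k) :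
    mk i j hij ◃ mk j k hjk = mk i k hik := by
  rw [mk_act]
  apply Subtype.ext
  simp [mk, Equiv.swap_apply_of_ne_of_ne hij hik]

theorem mk_act_of_disjoint {i j k l : Fin 5} (hij : i ≠ j) (hkl : k ≠ l)
    (hik : i ≠ k) (hil : i ≠ l) (hjk : j ≠ k) (hjl : j ≠ l) :
    mk i j hij ◃ mk k l hkl = mk i j hij := by
  rw [mk_act]
  apply Subtype.ext
  simp [mk, Equiv.swap_apply_of_ne_of_ne hik hil, Equiv.swap_apply_of_ne_of_ne hjk hjl]

theorem isConnected : IsConnected Transposition5 := by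
  have trans {x y z : Transposition5} (h₁ : ∃ g ∈ Inn Transposition5, g x = y)
      (h₂ : ∃ g ∈ Inn Transposition5, g y = z) : ∃ g ∈ Inn Transposition5, g x = z := by
    obtain ⟨g, hg, rfl⟩ := h₁
    obtain ⟨g', hg', rfl⟩ := h₂
    exact ⟨g' * g, mul_mem hg' hg, rfl⟩
  have step (i j k : Fin 5) (hij : i ≠ j) (hik : i ≠ k) :
      ∃ g ∈ Inn Transposition5, g (mk i j hij) = mk i k hik := by
    by_cases hjk : j = k
    · subst hjk
      exact ⟨1, one_mem _, rfl⟩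
    · exact ⟨rho (mk j k hjk), Subgroup.subset_closure ⟨_, rfl⟩, mk_act_of_adjacent hij hjk hik⟩
  intro x y
  obtain ⟨i, j, hij, rfl⟩ := exists_eq_mk x
  obtain ⟨k, l, hkl, rfl⟩ := exists_eq_mk y
  by_cases hil : i = l
  · subst hil
    rw [mk_comm k]
    exact step i j k hij hkl.symm
  · refine trans (step i j l hij hil) ?_
    rw [mk_comm i, mk_comm k]
    exact step l i k _ _

theorem card_eq_ten : Nat.card Transposition5 = 10 := by
  classical
  rw [Nat.card_eq_fintype_card, Fintype.card_subtype]
  simp only [← Equiv.Perm.card_support_eq_two]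
  decide +kernel

section Collapse

variable {R : Type*} [Quandle' R] {f : Transposition5 → R}

theorem map_mk_eq_of_adjacent (hf : IsHom f) {i j k : Fin 5} (hij : i ≠ j) (hik : i ≠ k)
    (hjk : j ≠ k) (h : f (mk i j hij) = f (mk i k hik)) (l : Fin 5) (hil : i ≠ l) :
    f (mk i l hil) = f (mk i j hij) := by
  by_cases hlj : l = j
  · subst hlj; rfl
  by_cases hlk : l = k
  · subst hlk; exact h.symm
  rw [← mk_act_of_adjacent hij (Ne.symm hlj) hil, hf, h, ← hf,
    mk_act_of_disjoint hik (Ne.symm hlj) hij hil hjk.symm (Ne.symm hlk)]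

theorem map_mk_eq_of_map_adjacent (hf : IsHom f) {i j k : Fin 5} (hij : i ≠ j) (hik : i ≠ k)
    (hjk : j ≠ k) (h : f (mk i j hij) = f (mk i k hik)) (x : Transposition5) :
    f x = f (mk i j hij) := by
  have star := map_mk_eq_of_adjacent hf hij hik hjk h
  obtain ⟨l, m, hlm, rfl⟩ := exists_eq_mk x
  by_cases hil : i = l
  · subst hil; exact star m hlm
  by_cases him : i = m
  · subst him; rw [mk_comm]; exact star l hil
  rw [mk_comm, ← mk_act_of_adjacent (Ne.symm him) hil hlm.symm, hf, star l hil,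
    mk_comm m, star m him, Quandle'.act_self]

theorem map_eq_of_map_eq (hf : IsHom f) {a b : Transposition5} (hab : a ≠ b) (h : f a = f b)
    (x : Transposition5) : f x = f a := by
  obtain ⟨i, j, hij, rfl⟩ := exists_eq_mk a
  obtain ⟨k, l, hkl, rfl⟩ := exists_eq_mk b
  by_cases hik : i = k
  · subst hik
    exact map_mk_eq_of_map_adjacent hf hij hkl (fun e => hab (by subst e; rfl)) h x
  by_cases hil : i = l
  · subst hil
    rw [mk_comm k] at h hab
    exact map_mk_eq_of_map_adjacent hf hij _ (fun e => hab (by subst e; rfl)) h x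
  by_cases hjk : j = k
  · subst hjk
    rw [mk_comm i] at h ⊢
    exact map_mk_eq_of_map_adjacent hf _ hkl hil h x
  by_cases hjl : j = l
  · subst hjl
    rw [mk_comm i, mk_comm k] at h
    rw [mk_comm i]
    exact map_mk_eq_of_map_adjacent hf _ _ hik h x
  obtain ⟨m, hmi, hmj, hmk, hml⟩ : ∃ m, m ≠ i ∧ m ≠ j ∧ m ≠ k ∧ m ≠ l := by
    clear * -
    decide +revert
  have h' : f (mk i j hij) = f (mk l m hml.symm) := by
    rw [← mk_act_of_adjacent hkl.symm hmk.symm hml.symm, hf, mk_comm l, ← h, ← hf,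
      mk_act_of_disjoint hij hmk.symm hik hmi.symm hjk hmj.symm]
  rw [h, mk_comm k] at h' ⊢
  exact map_mk_eq_of_map_adjacent hf _ _ hmk.symm h' x

end Collapse

theorem isSimple : IsSimple Transposition5 := by
  refine ⟨⟨mk 0 1 (by decide), mk 0 2 (by decide), fun h => ?_⟩, fun R _ f hf => ?_⟩
  · exact absurd (Subtype.ext_iff.mp h) (by decide)
  · refine or_iff_not_imp_left.mpr fun hinj a b => ?_
    simp only [Function.Injective, not_forall] at hinj
    obtain ⟨c, d, hcd, hne⟩ := hinj
    rw [map_eq_of_map_eq hf hne hcd a, map_eq_of_map_eq hf hne hcd b]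

end Transposition5

/-- The set of transpositions in `S₅`, under conjugation `a ◃ b = b⁻¹ * a * b`,
is a simple quandle with exactly `10` elements; in particular it is a connected
quandle of order `10`. -/
theorem transpositions_S5_simple_card_ten :
    IsSimple Transposition5 ∧ Nat.card Transposition5 = 10 ∧
      IsConnected Transposition5 := by
  exact ⟨Transposition5.isSimple, Transposition5.card_eq_ten, Transposition5.isConnected⟩
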